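/- Let κ be an infinite cardinal, d ≥ 1, k ≥ 2, and let P be a d-dimensional k-template. Let X_0, X_1, …, X_{d−1} be sets with |X_i| ≥ κ^{+i} for each i < d, and let X = X_0 × X_1 × ⋯ × X_{d−1}. Then χ(L(X,P)) ≥ κ. -/

import Mathlib

open Cardinal

/-- A hypergraph with vertex type `V` is identified with its set of edges
`E : Set (Set V)`.  It is `κ`-colorable if there is a function from `V` to a
set of cardinality at most `κ` that is not constant on any edge. -/
def HGColorable {V : Type} (E : Set (Set V)) (κ : Cardinal) : Prop :=
  ∃ (α : Type) (φ : V → α), #α ≤ κ ∧ ∀ e ∈ E, ∃ x ∈ e, ∃ y ∈ e, φ x ≠ φ y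

/-- The chromatic number of a hypergraph: the least cardinal `κ` such that it
has a proper `κ`-coloring. -/
noncomputable def chrNum {V : Type} (E : Set (Set V)) : Cardinal :=
  sInf {κ | HGColorable E κ}

/-- `cardSucc κ m = κ^{+m}`, the `m`-fold cardinal successor of `κ`. -/
noncomputable def cardSucc (κ : Cardinal) (m : ℕ) : Cardinal := (Order.succ)^[m] κ

/-- `Q` is a homomorphic image of the set `P` of `d`-tuples: there is a
surjection `f : P → Q` such that `x i = y i` implies `f x i = f y i`. -/
def IsHomImage {d : ℕ} {A : Type} {B : Fin d → Type} (P : Set (Fin d → A))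
    (Q : Set (∀ i, B i)) : Prop :=
  ∃ f : (Fin d → A) → (∀ i, B i),
    Set.MapsTo f P Q ∧ Set.SurjOn f P Q ∧
    ∀ x ∈ P, ∀ y ∈ P, ∀ i, x i = y i → f x i = f y i

/-- The edges of the template hypergraph `L(X, P)` where `X = Π i, B i`:
the `k`-element subsets of the vertex set that are homomorphic images of `P`. -/
def templateEdges (k : ℕ) {d : ℕ} {A : Type} {B : Fin d → Type}
    (P : Set (Fin d → A)) : Set (Set (∀ i, B i)) :=
  {Q | Q.ncard = k ∧ IsHomImage P Q}

/-- `I` is a distinguisher for `P`: any two distinct members of `P` differ at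
some coordinate in `I`. -/
def IsDistinguisher {d : ℕ} {A : Type} (P : Set (Fin d → A)) (I : Finset (Fin d)) : Prop :=
  ∀ x ∈ P, ∀ y ∈ P, x ≠ y → ∃ i ∈ I, x i ≠ y i

/-- `eDim P = e(P)`, the least cardinality of a distinguisher for `P`. -/
noncomputable def eDim {d : ℕ} {A : Type} (P : Set (Fin d → A)) : ℕ :=
  sInf {e | ∃ I : Finset (Fin d), IsDistinguisher P I ∧ I.card = e}

/-- A `d`-dimensional template is simple if for every `m < d` there are
`x, y ∈ P` with `x i = y i` exactly when `i ≠ m`. -/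
def IsSimple {d : ℕ} {A : Type} (P : Set (Fin d → A)) : Prop :=
  ∀ m : Fin d, ∃ x ∈ P, ∃ y ∈ P, ∀ i, (x i = y i ↔ i ≠ m)

/-- The edges of the zero hypergraph of a `(k, n)`-ary real polynomial:
`k`-element subsets `{a_0, …, a_{k-1}}` of `ℝⁿ` with `p(a_0, …, a_{k-1}) = 0`
for some ordering of the elements. -/
def zeroEdges {n k : ℕ} (p : MvPolynomial (Fin k × Fin n) ℝ) :
    Set (Set (Fin n → ℝ)) :=
  {A | ∃ a : Fin k → (Fin n → ℝ), Function.Injective a ∧ A = Set.range a ∧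
        MvPolynomial.eval (fun q => a q.1 q.2) p = 0}

/-- `H₂ = (V₂, E₂)` contains (a copy of) `H₁ = (V₁, E₁)`: some injection
`V₁ → V₂` maps every edge of `H₁` onto an edge of `H₂`. -/
def HGContains {V₁ V₂ : Type} (E₁ : Set (Set V₁)) (E₂ : Set (Set V₂)) : Prop :=
  ∃ f : V₁ → V₂, Function.Injective f ∧ ∀ e ∈ E₁, f '' e ∈ E₂

theorem Cardinal.mk_pi_lt_of_finite {ι : Type} [Finite ι] {Y : ι → Type} {μ : Cardinal}
    (hμ : ℵ₀ ≤ μ) (hY : ∀ i, #(Y i) < μ) : #(∀ i, Y i) < μ := by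
  have := Fintype.ofFinite ι
  rw [mk_pi, prod_eq_of_fintype, lift_id]
  refine Finset.prod_induction _ (· < μ) (fun a b ha hb => mul_lt_of_lt hμ ha hb)
    (one_lt_aleph0.trans_le hμ) (fun i _ => ?_)
  simpa using hY i

theorem strictMono_cardSucc (κ : Cardinal) : StrictMono (cardSucc κ) :=
  strictMono_nat_of_lt_succ fun n => by
    rw [cardSucc, cardSucc, Function.iterate_succ_apply']
    exact Order.lt_succ _

theorem le_cardSucc (κ : Cardinal) (n : ℕ) : κ ≤ cardSucc κ n :=
  (strictMono_cardSucc κ).monotone n.zero_le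

/-- A coloring of `Π i, X i` with fewer than `κ` colors, where `#(X i) = κ^{+i}`, admits
a monochromatic grid of any finite side length. -/
theorem exists_monochromatic_grid {κ : Cardinal} (hκ : ℵ₀ ≤ κ) {α : Type} (hα : #α < κ)
    (N : Type) [Finite N] (d : ℕ) (X : Fin d → Type)
    (hX : ∀ i, #(X i) = cardSucc κ (i : ℕ)) (φ : (∀ i, X i) → α) :
    ∃ g : ∀ i, N → X i, (∀ i, Function.Injective (g i)) ∧
      ∃ c, ∀ t : Fin d → N, φ (fun i => g i (t i)) = c := by
  induction d with
  | zero =>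
    exact ⟨fun i => i.elim0, fun i => i.elim0, φ fun i => i.elim0,
      fun t => congrArg φ (Subsingleton.elim _ _)⟩
  | succ d ih =>
    have hd : ℵ₀ ≤ cardSucc κ d := hκ.trans (le_cardSucc κ d)
    have hlast : #(X (Fin.last d)) = cardSucc κ d := hX _
    have : Infinite (X (Fin.last d)) := infinite_iff.2 (hlast ▸ hd)
    choose g hg c hc using fun y : X (Fin.last d) =>
      ih (fun i => X i.castSucc) (fun i => hX i.castSucc) fun x => φ (Fin.snoc x y)
    have hcard : #((∀ i : Fin d, N → X i.castSucc) × α) < #(X (Fin.last d)) := by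
      rw [hlast, ← mul_def]
      refine mul_lt_of_lt hd (mk_pi_lt_of_finite hd fun i => mk_pi_lt_of_finite hd fun _ => ?_)
        (hα.trans_le (le_cardSucc κ d))
      rw [hX]
      exact strictMono_cardSucc κ i.isLt
    obtain ⟨⟨g₀, c₀⟩, hinf⟩ := exists_infinite_fiber (fun y => (g y, c y)) hcard
    obtain ⟨n, ⟨e⟩⟩ := Finite.exists_equiv_fin N
    obtain ⟨h, hinj, hgh, hch⟩ : ∃ h : N → X (Fin.last d), Function.Injective h ∧
        (∀ a, g (h a) = g₀) ∧ ∀ a, c (h a) = c₀ := by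
      let h := e.toEmbedding.trans (Fin.valEmbedding.trans
        (Infinite.natEmbedding ((fun y => (g y, c y)) ⁻¹' {(g₀, c₀)})))
      exact ⟨fun a => h a, Subtype.val_injective.comp h.injective,
        fun a => congrArg Prod.fst (h a).2, fun a => congrArg Prod.snd (h a).2⟩
    refine ⟨Fin.snoc (α := fun i => N → X i) g₀ h, fun i => ?_, c₀, fun t => ?_⟩
    · induction i using Fin.lastCases with
      | last => simpa using hinj
      | cast i =>
        obtain ⟨y, hy⟩ := hinf.nonempty
        have hy : g y = g₀ := congrArg Prod.fst hy
        simpa [← hy] using hg y i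
    · rw [← hch (t (Fin.last d)), ← hc _ fun i => t i.castSucc]
      congr 1
      funext i
      induction i using Fin.lastCases with
      | last => simp
      | cast i => simp [hgh]

/-- Lemma 1.2: if `|X_i| ≥ κ^{+i}` for each `i < d` and
`X = X_0 × ⋯ × X_{d-1}`, then `χ(L(X, P)) ≥ κ`. -/
theorem statement8 (κ : Cardinal) (hκ : Cardinal.aleph0 ≤ κ) (d k : ℕ)
    (hd : 1 ≤ d) (hk : 2 ≤ k) (A : Type) (P : Set (Fin d → A)) (hP : P.ncard = k)
    (X : Fin d → Type) (hX : ∀ i : Fin d, cardSucc κ (i : ℕ) ≤ #(X i)) :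
    κ ≤ chrNum (templateEdges k (B := X) P) := by
  refine le_csInf ⟨#(∀ i, X i), _, id, le_rfl, fun e he => ?_⟩ ?_
  · exact (Set.one_lt_ncard_iff_nontrivial_and_finite.1 (hk.trans_eq he.1.symm)).1
  rintro μ ⟨α, φ, hα, hφ⟩
  by_contra! hμ
  have emb (i : Fin d) : Nonempty ((cardSucc κ (i : ℕ)).out ↪ X i) := by
    rw [← le_def, mk_out]
    exact hX i
  let emb (i : Fin d) := (emb i).some
  have hPfin : P.Finite := Set.finite_of_ncard_pos (by omega)
  obtain ⟨x₀, hx₀⟩ := Set.nonempty_of_ncard_ne_zero (s := P) (by omega)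
  let S : Set A := ⋃ i, (fun x : Fin d → A => x i) '' P
  have hS : ∀ x ∈ P, ∀ i, x i ∈ S := fun x hx i => Set.mem_iUnion.2 ⟨i, x, hx, rfl⟩
  have : Finite S := (Set.finite_iUnion fun i => hPfin.image _).to_subtype
  have : Nonempty S := ⟨⟨_, hS x₀ hx₀ ⟨0, hd⟩⟩⟩
  let r : A → S := Function.invFun Subtype.val
  have hr : ∀ a ∈ S, (r a : A) = a := fun a ha => Function.invFun_eq ⟨⟨a, ha⟩, rfl⟩
  obtain ⟨g, hg, c, hc⟩ := exists_monochromatic_grid hκ (hα.trans_lt hμ) S d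
    (fun i => (cardSucc κ (i : ℕ)).out) (fun i => mk_out _) fun x => φ fun i => emb i (x i)
  let f : (Fin d → A) → ∀ i, X i := fun x i => emb i (g i (r (x i)))
  have hf : Set.InjOn f P := fun x hx y hy hxy => funext fun i => by
    have h : r (x i) = r (y i) := hg i ((emb i).injective (congrFun hxy i))
    rw [← hr _ (hS x hx i), h, hr _ (hS y hy i)]
  obtain ⟨_, ⟨x, -, rfl⟩, _, ⟨y, -, rfl⟩, hxy⟩ := hφ (f '' P)
    ⟨by rw [hf.ncard_image, hP], f, Set.mapsTo_image f P, Set.surjOn_image f P,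
      fun x _ y _ i h => by simp only [f, h]⟩
  exact hxy ((hc fun i => r (x i)).trans (hc fun i => r (y i)).symm)
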